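/- Completeness of nPC: for every i ∈ {1,…,n}, every set Γ of nPC formulas, and every nPC formula F, if Γ ⊨_i F then the sequent Γ ⊢_i F is provable in nPC. -/

import Mathlib

/-- Formulas of the n-dimensional propositional calculus nPC:
decorated variables `X^π`, constants `e_k`, and compounds `q(F,G_1,…,G_n)`.
Dimensions are elements of `Fin n`; propositional variables are natural numbers. -/
inductive Fm (n : ℕ) : Type where
  | var (X : ℕ) (π : Equiv.Perm (Fin n)) : Fm n
  | const (k : Fin n) : Fm n
  | q (F : Fm n) (G : Fin n → Fm n) : Fm n

/-- The action `F^ρ` of a permutation `ρ` on a formula. -/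
def Fm.act {n : ℕ} (ρ : Equiv.Perm (Fin n)) : Fm n → Fm n
  | .var X π => .var X (ρ * π)
  | .const k => .const (ρ k)
  | .q F G => .q F (fun j => (G j).act ρ)

/-- The action of a permutation on a multiset of formulas (context). -/
def actM {n : ℕ} (ρ : Equiv.Perm (Fin n)) (Γ : Multiset (Fm n)) : Multiset (Fm n) :=
  Γ.map (Fm.act ρ)

/-- The sequent calculus of nPC: `Proves Γ i Δ` means the sequent `Γ ⊢_i Δ` is provable. -/
inductive Proves {n : ℕ} : Multiset (Fm n) → Fin n → Multiset (Fm n) → Prop where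
  | const (i : Fin n) : Proves 0 i {Fm.const i}
  | id (X : ℕ) (π ρ : Equiv.Perm (Fin n)) (i : Fin n) (h : π⁻¹ i = ρ⁻¹ i) :
      Proves {Fm.var X π} i {Fm.var X ρ}
  | sym (Γ Δ : Multiset (Fm n)) (i j : Fin n)
      (h : Proves (actM (Equiv.swap i j) Γ) i (actM (Equiv.swap i j) Δ)) :
      Proves Γ j Δ
  | neg1 (Γ Δ : Multiset (Fm n)) (F : Fm n) (i j k : Fin n) (hik : i ≠ k)
      (h : Proves (actM (Equiv.swap i j) Γ) i (F ::ₘ actM (Equiv.swap i j) Δ)) :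
      Proves (F.act (Equiv.swap j k) ::ₘ Γ) j Δ
  | neg2 (Γ Δ : Multiset (Fm n)) (F : Fm n) (i j k : Fin n) (hjk : j ≠ k)
      (h : Proves (actM (Equiv.swap i j) Γ) i (F ::ₘ actM (Equiv.swap i j) Δ)) :
      Proves (F.act (Equiv.swap i k) ::ₘ Γ) j Δ
  | neg3 (Γ Δ : Multiset (Fm n)) (F : Fm n) (j : Fin n)
      (h : ∀ i : Fin n, i ≠ j →
        Proves (F ::ₘ actM (Equiv.swap i j) Γ) i (actM (Equiv.swap i j) Δ)) :
      Proves Γ j (F ::ₘ Δ)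
  | qL (Γ Δ : Multiset (Fm n)) (F : Fm n) (G : Fin n → Fm n) (i : Fin n)
      (h : ∀ j : Fin n,
        Proves ((G j).act (Equiv.swap j i) ::ₘ F ::ₘ actM (Equiv.swap j i) Γ) j
          (actM (Equiv.swap j i) Δ)) :
      Proves (Fm.q F G ::ₘ Γ) i Δ
  | qR (Γ Δ : Multiset (Fm n)) (F : Fm n) (G : Fin n → Fm n) (i : Fin n)
      (h : ∀ j : Fin n,
        Proves (F ::ₘ actM (Equiv.swap j i) Γ) j
          ((G j).act (Equiv.swap j i) ::ₘ actM (Equiv.swap j i) Δ)) :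
      Proves Γ i (Fm.q F G ::ₘ Δ)
  | cut (Γ Δ : Multiset (Fm n)) (F : Fm n) (i : Fin n)
      (h1 : Proves (F ::ₘ Γ) i Δ) (h2 : Proves Γ i (F ::ₘ Δ)) : Proves Γ i Δ
  | weakL (Γ Δ : Multiset (Fm n)) (F : Fm n) (i : Fin n)
      (h : Proves Γ i Δ) : Proves (F ::ₘ Γ) i Δ
  | weakR (Γ Δ : Multiset (Fm n)) (F : Fm n) (i : Fin n)
      (h : Proves Γ i Δ) : Proves Γ i (F ::ₘ Δ)
  | conL (Γ Δ : Multiset (Fm n)) (F : Fm n) (i : Fin n)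
      (h : Proves (F ::ₘ F ::ₘ Γ) i Δ) : Proves (F ::ₘ Γ) i Δ
  | conR (Γ Δ : Multiset (Fm n)) (F : Fm n) (i : Fin n)
      (h : Proves Γ i (F ::ₘ F ::ₘ Δ)) : Proves Γ i (F ::ₘ Δ)

/-- The semantics `⟦F⟧v` of a formula in an environment `v`. -/
def Fm.sem {n : ℕ} (v : ℕ → Fin n) : Fm n → Fin n
  | .var X π => π (v X)
  | .const k => k
  | .q F G => (G (F.sem v)).sem v

/-- `Γ ⊨_i Δ`: every environment making all of `Γ` equal `i` makes some formula of `Δ` equal `i`. -/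
def Models {n : ℕ} (Γ : Multiset (Fm n)) (i : Fin n) (Δ : Multiset (Fm n)) : Prop :=
  ∀ v : ℕ → Fin n, (∀ G ∈ Γ, Fm.sem v G = i) → ∃ F ∈ Δ, Fm.sem v F = i

/-- Logical equivalence `F ∼ G`: both `F ⊢_i G` and `G ⊢_i F` are provable for every `i`. -/
def Eqv {n : ℕ} (F G : Fm n) : Prop :=
  ∀ i : Fin n, Proves {F} i {G} ∧ Proves {G} i {F}

/-- Provability from a (possibly infinite) set of hypotheses:
some finite sub-multiset of `Γ` proves `Δ` at `i`. -/
def ProvesSet {n : ℕ} (Γ : Set (Fm n)) (i : Fin n) (Δ : Multiset (Fm n)) : Prop :=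
  ∃ Γ' : Multiset (Fm n), (∀ G ∈ Γ', G ∈ Γ) ∧ Proves Γ' i Δ

/-- `Γ ⊨_i F` for a set `Γ` of hypotheses. -/
def ModelsSet {n : ℕ} (Γ : Set (Fm n)) (i : Fin n) (F : Fm n) : Prop :=
  ∀ v : ℕ → Fin n, (∀ G ∈ Γ, Fm.sem v G = i) → Fm.sem v F = i

namespace Fm

variable {n : ℕ}

theorem act_one (F : Fm n) : F.act 1 = F := by
  induction F with
  | var X π => simp [act]
  | const k => simp [act]
  | q F G _ ihG => simp [act, ihG]

theorem act_act (σ ρ : Equiv.Perm (Fin n)) (F : Fm n) :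
    (F.act ρ).act σ = F.act (σ * ρ) := by
  induction F with
  | var X π => simp [act, mul_assoc]
  | const k => simp [act]
  | q F G _ ihG => simp [act, ihG]

theorem act_swap_self (i : Fin n) (F : Fm n) : F.act (Equiv.swap i i) = F := by
  rw [Equiv.swap_self]
  exact F.act_one

end Fm

theorem actM_swap_actM_swap {n : ℕ} (i j : Fin n) (Γ : Multiset (Fm n)) :
    actM (Equiv.swap i j) (actM (Equiv.swap j i) Γ) = Γ := by
  simp [actM, Fm.act_act, Equiv.swap_comm j i, Fm.act_one]

namespace Proves

variable {n : ℕ} {Γ Γ' Δ : Multiset (Fm n)} {i : Fin n}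

theorem add_left (Γ' : Multiset (Fm n)) (h : Proves Γ i Δ) : Proves (Γ' + Γ) i Δ := by
  induction Γ' using Multiset.induction with
  | empty => simpa using h
  | cons A Γ' ih => simpa using weakL _ _ A _ ih

theorem absorb_left (h : Proves (Γ + Γ') i Δ) (hsub : Γ ⊆ Γ') : Proves Γ' i Δ := by
  induction Γ using Multiset.induction with
  | empty => simpa using h
  | cons A Γ ih =>
    obtain ⟨hA, hΓ⟩ := Multiset.cons_subset.1 hsub
    refine ih ?_ hΓ
    obtain ⟨T, rfl⟩ := Multiset.exists_cons_of_mem hA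
    simp only [Multiset.cons_add, Multiset.add_cons] at h ⊢
    exact conL _ _ _ _ h

theorem mono_left (h : Proves Γ i Δ) (hsub : Γ ⊆ Γ') : Proves Γ' i Δ := by
  refine absorb_left (Γ := Γ) ?_ hsub
  rw [add_comm]
  exact h.add_left Γ'

theorem weaken_right {A : Fm n} (Δ : Multiset (Fm n)) (h : Proves Γ i {A}) :
    Proves Γ i (A ::ₘ Δ) := by
  induction Δ using Multiset.induction with
  | empty => exact h
  | cons B Δ ih =>
    rw [Multiset.cons_swap]
    exact weakR _ _ B _ ih

/-- A formula asserted to take the value `i` can be moved to the left of `⊢_j` for `j ≠ i`. -/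
theorem neg_left {j : Fin n} {F : Fm n} (hij : i ≠ j)
    (h : Proves (actM (Equiv.swap i j) Γ) i (F ::ₘ actM (Equiv.swap i j) Δ)) :
    Proves (F ::ₘ Γ) j Δ := by
  simpa only [Fm.act_swap_self] using neg1 Γ Δ F i j j hij h

/-- If decorations of `F` asserting the same value entail each other, then decorations
asserting different values are contradictory. -/
theorem conflict_of_entails {F : Fm n}
    (hF : ∀ (π ρ : Equiv.Perm (Fin n)) (i : Fin n), π⁻¹ i = ρ⁻¹ i →
      Proves {F.act π} i {F.act ρ})
    (π ρ : Equiv.Perm (Fin n)) (i : Fin n) (h : π⁻¹ i ≠ ρ⁻¹ i) :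
    Proves (F.act ρ ::ₘ {F.act π}) i 0 := by
  have hne : ρ (π⁻¹ i) ≠ i := fun he => h (Equiv.Perm.eq_inv_iff_eq.2 he)
  refine neg_left hne ?_
  simpa [actM, Fm.act_act] using
    hF (Equiv.swap (ρ (π⁻¹ i)) i * π) ρ (ρ (π⁻¹ i)) (by simp [mul_inv_rev])

theorem const_left {k : Fin n} (h : k ≠ i) : Proves {Fm.const k} i 0 :=
  neg_left (Γ := 0) h (const k)

/-- Decorations of the same formula asserting the same value entail each other. -/
theorem entails (F : Fm n) : ∀ (π ρ : Equiv.Perm (Fin n)) (i : Fin n), π⁻¹ i = ρ⁻¹ i →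
    Proves {F.act π} i {F.act ρ} := by
  induction F with
  | var X τ =>
    intro π ρ i h
    exact id X _ _ i (by simpa [mul_inv_rev] using h)
  | const k =>
    intro π ρ i h
    by_cases hk : π k = i
    · have hk' : ρ k = i := by
        rw [← Equiv.Perm.eq_inv_iff_eq, ← h, Equiv.Perm.eq_inv_iff_eq, hk]
      simp only [Fm.act, hk']
      exact (const i).mono_left (Multiset.zero_subset _)
    · exact weakR _ _ _ _ (const_left hk)
  | q F G ihF ihG =>
    intro π ρ i h
    refine qR _ 0 _ _ _ fun j => ?_
    simp only [actM, Multiset.map_singleton, Multiset.map_zero, Fm.act]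
    rw [← Multiset.cons_zero (Fm.q _ _), Multiset.cons_swap]
    refine qL _ _ _ _ _ fun k => ?_
    simp only [actM, Multiset.map_singleton, Multiset.cons_zero, Fm.act_act]
    by_cases hkj : k = j
    · subst hkj
      refine (ihG k (Equiv.swap k k * (Equiv.swap k i * π)) (Equiv.swap k k * (Equiv.swap k i * ρ))
        k (by simpa [mul_inv_rev] using h)).mono_left (by simp)
    · refine weakR _ _ _ _ ?_
      have := conflict_of_entails ihF (Equiv.swap k j) 1 k (by simpa using Ne.symm hkj)
      rw [Fm.act_one] at this
      exact weakL _ _ _ _ this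

/-- Decorations of the same formula asserting different values are contradictory. -/
theorem conflict (F : Fm n) (π ρ : Equiv.Perm (Fin n)) (i : Fin n) (h : π⁻¹ i ≠ ρ⁻¹ i) :
    Proves (F.act ρ ::ₘ {F.act π}) i 0 :=
  conflict_of_entails (entails F) π ρ i h

/-- Case analysis on the value of a formula. -/
theorem of_forall_value (F : Fm n)
    (h : ∀ j, Proves (F.act (Equiv.swap j i) ::ₘ Γ) i Δ) : Proves Γ i Δ := by
  refine cut Γ Δ F i ?_ (neg3 _ _ _ _ fun j _ => sym _ _ i j ?_)
  · simpa only [Fm.act_swap_self] using h i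
  · have hΓ := actM_swap_actM_swap i j Γ
    have hΔ := actM_swap_actM_swap i j Δ
    unfold actM at hΓ hΔ ⊢
    rw [Multiset.map_cons, hΓ, hΔ, Equiv.swap_comm]
    exact h j

/-- The value of a compound formula is determined by those of its head and selected branch. -/
theorem q_right (F : Fm n) (G : Fin n → Fm n) (i a b : Fin n) :
    Proves {F.act (Equiv.swap a i), (G a).act (Equiv.swap b i)} i
      {(Fm.q F G).act (Equiv.swap b i)} := by
  refine qR _ 0 _ _ _ fun j => ?_
  simp only [actM, Multiset.insert_eq_cons, Multiset.map_singleton, Multiset.map_cons,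
    Multiset.map_zero, Multiset.cons_zero, Fm.act_act]
  by_cases hja : j = a
  · subst hja
    exact (entails (G j) _ _ j rfl).mono_left (by simp)
  · refine weakR _ _ _ _ ((conflict F (Equiv.swap j i * Equiv.swap a i) 1 j ?_).mono_left ?_)
    · simpa [mul_inv_rev] using Ne.symm hja
    · rw [Fm.act_one]
      intro A
      simp only [Multiset.mem_cons, Multiset.mem_singleton]
      tauto

end Proves

namespace ProvesSet

variable {n : ℕ} {Γ S : Set (Fm n)} {i : Fin n} {Δ : Multiset (Fm n)}

theorem mono (h : ProvesSet Γ i Δ) (hsub : Γ ⊆ S) : ProvesSet S i Δ :=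
  let ⟨Γ', hΓ', hp⟩ := h
  ⟨Γ', fun G hG => hsub (hΓ' G hG), hp⟩

theorem exists_cons_of_insert {A : Fm n} (h : ProvesSet (insert A S) i Δ) :
    ∃ Γ' : Multiset (Fm n), (∀ G ∈ Γ', G ∈ S) ∧ Proves (A ::ₘ Γ') i Δ := by
  classical
  obtain ⟨Γ', hΓ', hp⟩ := h
  refine ⟨Γ'.filter (· ∈ S), fun G hG => (Multiset.mem_filter.1 hG).2, hp.mono_left ?_⟩
  intro G hG
  rcases hΓ' G hG with rfl | hS
  · exact Multiset.mem_cons_self _ _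
  · exact Multiset.mem_cons_of_mem (Multiset.mem_filter.2 ⟨hG, hS⟩)

theorem of_forall_value (F : Fm n)
    (h : ∀ j, ProvesSet (insert (F.act (Equiv.swap j i)) S) i Δ) : ProvesSet S i Δ := by
  choose Γ' hΓ' hp using fun j => (h j).exists_cons_of_insert
  refine ⟨∑ j, Γ' j, fun G hG => ?_, Proves.of_forall_value F fun j => (hp j).mono_left ?_⟩
  · obtain ⟨j, -, hj⟩ := Multiset.mem_sum.1 hG
    exact hΓ' j G hj
  · exact Multiset.cons_subset_cons fun G hG => Multiset.mem_sum.2 ⟨j, Finset.mem_univ j, hG⟩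

theorem cut {A : Fm n} (hA : ProvesSet S i {A})
    (hΔ : ProvesSet (insert A S) i Δ) : ProvesSet S i Δ := by
  obtain ⟨Γ₁, hΓ₁, hp₁⟩ := hA
  obtain ⟨Γ₂, hΓ₂, hp₂⟩ := hΔ.exists_cons_of_insert
  refine ⟨Γ₁ + Γ₂, fun G hG => (Multiset.mem_add.1 hG).elim (hΓ₁ G) (hΓ₂ G),
    Proves.cut _ _ A _ (hp₂.mono_left ?_) ((hp₁.weaken_right Δ).mono_left ?_)⟩
  · exact Multiset.cons_subset_cons (Multiset.subset_of_le (Multiset.le_add_left _ _))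
  · exact Multiset.subset_of_le (Multiset.le_add_right _ _)

theorem isOfFiniteCharacter (i : Fin n) (Δ : Multiset (Fm n)) :
    Order.IsOfFiniteCharacter {S : Set (Fm n) | ¬ ProvesSet S i Δ} := by
  refine fun S => ⟨fun hS T hT _ hp => hS (hp.mono hT), ?_⟩
  rintro hfin ⟨Γ', hΓ', hp⟩
  exact hfin {G | G ∈ Γ'} hΓ' (Multiset.finite_toSet Γ') ⟨Γ', fun _ hG => hG, hp⟩

end ProvesSet

section Maximal

variable {n : ℕ} {S : Set (Fm n)} {i : Fin n} {Δ : Multiset (Fm n)}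

theorem Maximal.provesSet_insert (hS : Maximal (· ∈ {S | ¬ ProvesSet S i Δ}) S) {A : Fm n}
    (hA : A ∉ S) : ProvesSet (insert A S) i Δ := by
  by_contra hc
  exact hA (hS.le_of_ge hc (Set.subset_insert A S) (Set.mem_insert A S))

/-- Sets maximal among those not proving a given sequent are deductively closed. -/
theorem Maximal.mem_of_proves (hS : Maximal (· ∈ {S | ¬ ProvesSet S i Δ}) S) {A : Fm n}
    {Γ' : Multiset (Fm n)} (hΓ' : ∀ G ∈ Γ', G ∈ S) (hp : Proves Γ' i {A}) : A ∈ S := by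
  by_contra hA
  exact hS.prop (ProvesSet.cut ⟨Γ', hΓ', hp⟩ (hS.provesSet_insert hA))

theorem Maximal.exists_value (hS : Maximal (· ∈ {S | ¬ ProvesSet S i Δ}) S) (F : Fm n) :
    ∃ j, F.act (Equiv.swap j i) ∈ S := by
  by_contra! hF
  exact hS.prop (ProvesSet.of_forall_value F fun j => hS.provesSet_insert (hF j))

/-- A maximal set contains the assertion that `F` takes its value in the environment read off
from the set. -/
theorem Maximal.act_sem_mem (hS : Maximal (· ∈ {S | ¬ ProvesSet S i Δ}) S) {v : ℕ → Fin n}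
    (hv : ∀ X, (Fm.var X 1).act (Equiv.swap (v X) i) ∈ S) (F : Fm n) :
    F.act (Equiv.swap (F.sem v) i) ∈ S := by
  induction F with
  | var X π =>
    refine hS.mem_of_proves (Γ' := {(Fm.var X 1).act (Equiv.swap (v X) i)}) (by simpa using hv X) ?_
    exact Proves.id X _ _ i (by simp [mul_inv_rev, Fm.sem])
  | const k =>
    refine hS.mem_of_proves (Γ' := 0) (by simp) ?_
    simpa [Fm.act, Fm.sem] using Proves.const i
  | q F G ihF ihG =>
    refine hS.mem_of_proves ?_ (Proves.q_right F G i (F.sem v) ((G (F.sem v)).sem v))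
    simpa using ⟨ihF, ihG (F.sem v)⟩

theorem Maximal.sem_eq_of_mem {A : Fm n} (hS : Maximal (· ∈ {S | ¬ ProvesSet S i {A}}) S)
    {v : ℕ → Fin n} (hv : ∀ X, (Fm.var X 1).act (Equiv.swap (v X) i) ∈ S) {F : Fm n}
    (hF : F ∈ S) : F.sem v = i := by
  by_contra hne
  have hp := Proves.conflict F (Equiv.swap (F.sem v) i) 1 i (by simpa using hne)
  rw [Fm.act_one] at hp
  refine hS.prop ⟨_, ?_, Proves.weakR _ _ A _ hp⟩
  simpa using ⟨hF, hS.act_sem_mem hv F⟩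

end Maximal

/-- Completeness of nPC: if `Γ ⊨_i F` then the sequent `Γ ⊢_i F` is provable
(some finite sub-multiset of `Γ` proves `F` at `i`). -/
theorem nPC_completeness (n : ℕ) (hn : 2 ≤ n) (i : Fin n) (Γ : Set (Fm n)) (F : Fm n)
    (h : ModelsSet Γ i F) : ProvesSet Γ i {F} := by
  by_contra hΓ
  obtain ⟨S, hsub, hS⟩ := (ProvesSet.isOfFiniteCharacter i {F}).exists_maximal hΓ
  choose v hv using fun X => hS.exists_value (Fm.var X 1)
  have hF := hS.act_sem_mem hv F
  rw [h v fun G hG => hS.sem_eq_of_mem hv (hsub hG), Fm.act_swap_self] at hF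
  refine hS.prop ⟨{F}, by simpa using hF, ?_⟩
  simpa [Fm.act_one] using Proves.entails F 1 1 i rfl
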